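/- Under the standing assumptions, and with E_0 a constant as specified, there exists L_1 > 0 such that for every natural number L > L_1, every ε > 0, and every n ∈ ℕ with m := ⌈εn⌉ ≥ 1, every g ∈ W_{L,ε}(n) satisfies d_X(x_0, g^k x_0) ≥ (1/2)·τ·L·m·k for all integers k ≥ 1; in particular g is a loxodromic isometry of X with τ_X(g) ≥ (1/2)·τ·L·m. -/

import Mathlib

namespace AcylCount

/-! ### Geodesic segments and Gromov hyperbolicity -/

/-- A finite geodesic segment in a metric space, parametrized by arclength on `[0, len]`,
oriented from `initial := toFun 0` to `terminal := toFun len`. -/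
structure GeodesicSegment (X : Type*) [MetricSpace X] where
  len : ℝ
  len_nonneg : 0 ≤ len
  toFun : ℝ → X
  isom : ∀ s ∈ Set.Icc (0:ℝ) len, ∀ t ∈ Set.Icc (0:ℝ) len,
    dist (toFun s) (toFun t) = |s - t|

namespace GeodesicSegment

variable {X : Type*} [MetricSpace X]

/-- The initial point of a geodesic segment. -/
def initial (γ : GeodesicSegment X) : X := γ.toFun 0

/-- The terminal point of a geodesic segment. -/
def terminal (γ : GeodesicSegment X) : X := γ.toFun γ.len

/-- The image (underlying set) of a geodesic segment. -/
def seg (γ : GeodesicSegment X) : Set X := γ.toFun '' Set.Icc 0 γ.len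

/-- The translate of a geodesic segment by an isometry. -/
def translate (γ : GeodesicSegment X) (f : X → X) (hf : Isometry f) :
    GeodesicSegment X where
  len := γ.len
  len_nonneg := γ.len_nonneg
  toFun := f ∘ γ.toFun
  isom := fun s hs t ht => by
    simp only [Function.comp_apply, hf.dist_eq]
    exact γ.isom s hs t ht

/-- The degenerate geodesic segment consisting of a single point. -/
def point (p : X) : GeodesicSegment X where
  len := 0
  len_nonneg := le_refl 0
  toFun := fun _ => p
  isom := fun s hs t ht => by
    have hs0 : s = 0 := le_antisymm hs.2 hs.1
    have ht0 : t = 0 := le_antisymm ht.2 ht.1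
    simp [hs0, ht0]

/-- `η` is a subsegment of `γ`. -/
def IsSubsegment (η γ : GeodesicSegment X) : Prop :=
  ∃ a b : ℝ, 0 ≤ a ∧ a ≤ b ∧ b ≤ γ.len ∧ η.len = b - a ∧
    ∀ t ∈ Set.Icc (0:ℝ) η.len, η.toFun t = γ.toFun (a + t)

/-- `p` occurs (weakly) before `q` along the oriented geodesic segment `γ`. -/
def Before (γ : GeodesicSegment X) (p q : X) : Prop :=
  ∃ s t : ℝ, s ∈ Set.Icc (0:ℝ) γ.len ∧ t ∈ Set.Icc (0:ℝ) γ.len ∧ s ≤ t ∧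
    γ.toFun s = p ∧ γ.toFun t = q

end GeodesicSegment

/-- A geodesic metric space: every two points are joined by a geodesic segment. -/
def IsGeodesicSpace (X : Type*) [MetricSpace X] : Prop :=
  ∀ x y : X, ∃ γ : GeodesicSegment X, γ.initial = x ∧ γ.terminal = y

/-- δ-hyperbolicity via slim triangles: each side of a geodesic triangle lies in the
closed δ-neighborhood of the union of the other two sides. -/
def IsDeltaHyperbolic (X : Type*) [MetricSpace X] (δ : ℝ) : Prop :=
  ∀ γ₁ γ₂ γ₃ : GeodesicSegment X,
    γ₁.initial = γ₃.initial → γ₁.terminal = γ₂.initial → γ₂.terminal = γ₃.terminal →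
    γ₃.seg ⊆ Metric.cthickening δ (γ₁.seg ∪ γ₂.seg)

variable {X : Type*} [MetricSpace X]

/-- The closest point projection of `x` to (the image of) the geodesic `γ`. -/
def proj (γ : GeodesicSegment X) (x : X) : Set X :=
  {p | p ∈ γ.seg ∧ dist x p = Metric.infDist x γ.seg}

/-- The closest point projection of a set `A` to the geodesic `γ`. -/
def projSet (γ : GeodesicSegment X) (A : Set X) : Set X :=
  ⋃ a ∈ A, proj γ a

/-- The ordered pair of oriented geodesic segments `(γ, η)` is `K`-aligned. -/
def AlignedPair (K : ℝ) (γ η : GeodesicSegment X) : Prop :=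
  Metric.diam (projSet γ η.seg ∪ {γ.terminal}) < K ∧
  Metric.diam (projSet η γ.seg ∪ {η.initial}) < K

/-- A sequence of oriented geodesic segments is `K`-aligned if each consecutive
pair is `K`-aligned. -/
def AlignedSeq (K : ℝ) (l : List (GeodesicSegment X)) : Prop :=
  l.Chain' (AlignedPair K)

/-- The Gromov product `(y, z)_x`. -/
noncomputable def gromovProd (x y z : X) : ℝ := (dist y x + dist x z - dist y z) / 2

/-! ### Word metric -/

variable {G : Type*} [Group G]

/-- The word length of `g` with respect to the (symmetrized) generating set `S`. -/
noncomputable def wordLength (S : Finset G) (g : G) : ℕ :=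
  sInf {n | ∃ l : List G, l.length = n ∧ (∀ x ∈ l, x ∈ S ∨ x⁻¹ ∈ S) ∧ l.prod = g}

/-- The word metric on `G` with respect to `S`. -/
noncomputable def wordDist (S : Finset G) (g h : G) : ℕ := wordLength S (g⁻¹ * h)

/-- The ball of radius `r` in the word metric, centered at the identity. -/
def ball (S : Finset G) (r : ℝ) : Set G := {g | (wordLength S g : ℝ) ≤ r}

/-- `G` has no cyclic subgroup of finite index. -/
def NonVirtuallyCyclic (G : Type*) [Group G] : Prop :=
  ¬ ∃ H : Subgroup G, H.FiniteIndex ∧ IsCyclic H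

/-! ### Isometric actions, loxodromics, WPD -/

/-- `g` is a loxodromic isometry for the action `ρ` with basepoint `x0`: the asymptotic
translation length `τ_X(g) = lim dist x0 (g^n x0) / n` exists and is positive. -/
def IsLoxodromic (ρ : G → X → X) (x0 : X) (g : G) : Prop :=
  ∃ τ : ℝ, 0 < τ ∧
    Filter.Tendsto (fun n : ℕ => dist x0 (ρ (g ^ n) x0) / n) Filter.atTop (nhds τ)

/-- The WPD (weak proper discontinuity) property of `g` for the action `ρ` with
basepoint `x0`. -/
def HasWPD (ρ : G → X → X) (x0 : X) (g : G) : Prop :=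
  ∀ K : ℝ, 0 < K → ∃ N M : ℕ,
    {h : G | dist x0 (ρ h x0) < K ∧ dist (ρ (g ^ N) x0) (ρ h (ρ (g ^ N) x0)) < K}.Finite ∧
    {h : G | dist x0 (ρ h x0) < K ∧ dist (ρ (g ^ N) x0) (ρ h (ρ (g ^ N) x0)) < K}.ncard < M

/-- The list of translated geodesics `h 1 • Υ, …, h m • Υ`. -/
def transList (ρ : G → X → X) (hisom : ∀ g : G, Isometry (ρ g))
    (Υ : GeodesicSegment X) (h : ℕ → G) (m : ℕ) : List (GeodesicSegment X) :=
  (List.range m).map fun i => Υ.translate (ρ (h (i + 1))) (hisom _)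

/-- The specification of the constant `E₀` from Fact 2.7 (Bestvina–Fujiwara):
(i) Gromov product bounds, (ii) the WPD-type conclusion for large projections. -/
def E0Spec (S : Finset G) (ρ : G → X → X) (x0 : X) (φ : G) (E0 : ℝ) : Prop :=
  0 < E0 ∧
  (∀ g : G, ∃ s t : G, (s ∈ S ∨ s = 1) ∧ (t ∈ S ∨ t = 1) ∧
    (∀ i : ℤ, 0 < i → gromovProd x0 (ρ (φ ^ i) x0) (ρ (s * g) x0) ≤ E0) ∧
    (∀ j : ℤ, j < 0 → gromovProd x0 (ρ (φ ^ j) x0) (ρ (t * g) x0) ≤ E0)) ∧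
  (∀ n : ℕ, 0 < n → ∀ g : G, ∀ γ : GeodesicSegment X,
    γ.initial = x0 → γ.terminal = ρ (φ ^ n) x0 →
    ∀ p ∈ proj γ (ρ g x0), ∀ q ∈ proj γ (ρ (g * φ ^ n) x0),
      γ.Before p q → E0 < dist p q →
      ∃ i j : ℕ, i ≤ n ∧ j ≤ n ∧ (wordDist S (φ ^ i) (g * φ ^ j) : ℝ) < E0)

/-- The set `V_{L,ε}(n)`. Here `Υ` is the chosen geodesic `Υ_L = [x₀, φ^L x₀]`. -/
def Vset (S : Finset G) (ρ : G → X → X) (hisom : ∀ g : G, Isometry (ρ g)) (x0 : X)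
    (δ E0 : ℝ) (Υ : GeodesicSegment X) (ε : ℝ) (n : ℕ) : Set G :=
  {g | g ∈ ball S (n:ℝ) ∧ ∃ h : ℕ → G,
    AlignedSeq (6 * E0 + 300 * δ)
      ([GeodesicSegment.point x0] ++ transList ρ hisom Υ h ⌈ε * (n:ℝ)⌉₊ ++
        [GeodesicSegment.point (ρ g x0)])}

/-- The set `W_{L,ε}(n)`. Here `Υ` is the chosen geodesic `Υ_L = [x₀, φ^L x₀]`. -/
def Wset (S : Finset G) (ρ : G → X → X) (hisom : ∀ g : G, Isometry (ρ g)) (x0 : X)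
    (δ E0 : ℝ) (Υ : GeodesicSegment X) (ε : ℝ) (n : ℕ) : Set G :=
  {g | g ∈ ball S (n:ℝ) ∧ ∃ h : ℕ → G,
    AlignedSeq (6 * E0 + 360 * δ)
      ([GeodesicSegment.point x0] ++ transList ρ hisom Υ h ⌈ε * (n:ℝ)⌉₊ ++
        [GeodesicSegment.point (ρ g x0)]) ∧
    AlignedPair (6 * E0 + 360 * δ) (GeodesicSegment.point (ρ g⁻¹ x0))
      (Υ.translate (ρ (h 1)) (hisom _)) ∧
    AlignedPair (6 * E0 + 360 * δ) (Υ.translate (ρ (h ⌈ε * (n:ℝ)⌉₊)) (hisom _))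
      (GeodesicSegment.point (ρ (g ^ 2) x0))}

/-- The set `BAD_{L,ε}(n)`. -/
def BADset (S : Finset G) (ρ : G → X → X) (hisom : ∀ g : G, Isometry (ρ g)) (x0 : X)
    (δ E0 : ℝ) (Υ : GeodesicSegment X) (ε : ℝ) (n : ℕ) : Set G :=
  ball S (n:ℝ) \ (ball S ((⌊(0.9:ℝ) * (n:ℝ)⌋₊ : ℕ) : ℝ) ∪ Vset S ρ hisom x0 δ E0 Υ ε n)

/-! ### Paths in the word metric -/

/-- `P` is a `d_S`-path connecting `a` to `b`. -/
noncomputable def IsPathFrom (S : Finset G) (P : List G) (a b : G) : Prop :=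
  P ≠ [] ∧ P.Chain' (fun u v => wordDist S u v = 1) ∧ P.head? = some a ∧ P.getLast? = some b

/-- The distance `d_S(P, g)` from a path `P` to a group element `g`. -/
noncomputable def pathDist (S : Finset G) (P : List G) (g : G) : ℕ :=
  sInf {d | ∃ v ∈ P, d = wordDist S v g}


/-! ### Four-point hyperbolicity from slim triangles -/

section Hyperbolic

variable {X : Type*} [MetricSpace X]

/-- Gromov's four-point condition with constant `D`. -/
def FourPoint (X : Type*) [MetricSpace X] (D : ℝ) : Prop :=
  ∀ w x y z : X, gromovProd w x y ≤ gromovProd w x z + D ∨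
    gromovProd w y z ≤ gromovProd w x z + D

theorem gromovProd_comm (w x y : X) : gromovProd w x y = gromovProd w y x := by
  simp only [gromovProd, dist_comm]
  ring

theorem gromovProd_isometry {f : X → X} (hf : Isometry f) (w x y : X) :
    gromovProd (f w) (f x) (f y) = gromovProd w x y := by
  simp only [gromovProd, hf.dist_eq]

namespace GeodesicSegment

theorem continuousOn (γ : GeodesicSegment X) : ContinuousOn γ.toFun (Set.Icc 0 γ.len) := by
  have h : LipschitzOnWith 1 γ.toFun (Set.Icc 0 γ.len) :=
    LipschitzOnWith.of_dist_le_mul fun s hs t ht => by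
      simp [γ.isom s hs t ht, Real.dist_eq]
  exact h.continuousOn

theorem isCompact_seg (γ : GeodesicSegment X) : IsCompact γ.seg :=
  isCompact_Icc.image_of_continuousOn γ.continuousOn

theorem isPreconnected_seg (γ : GeodesicSegment X) : IsPreconnected γ.seg :=
  isPreconnected_Icc.image _ γ.continuousOn

theorem initial_mem (γ : GeodesicSegment X) : γ.initial ∈ γ.seg :=
  ⟨0, ⟨le_rfl, γ.len_nonneg⟩, rfl⟩

theorem terminal_mem (γ : GeodesicSegment X) : γ.terminal ∈ γ.seg :=
  ⟨γ.len, ⟨γ.len_nonneg, le_rfl⟩, rfl⟩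

theorem dist_add_dist_of_mem (γ : GeodesicSegment X) {p : X} (hp : p ∈ γ.seg) :
    dist γ.initial p + dist p γ.terminal = dist γ.initial γ.terminal := by
  obtain ⟨t, ht, rfl⟩ := hp
  have h0 : (0 : ℝ) ∈ Set.Icc 0 γ.len := ⟨le_rfl, γ.len_nonneg⟩
  have h1 : γ.len ∈ Set.Icc 0 γ.len := ⟨γ.len_nonneg, le_rfl⟩
  simp only [initial, terminal]
  rw [γ.isom _ h0 _ ht, γ.isom _ ht _ h1, γ.isom _ h0 _ h1, abs_of_nonpos (by linarith [ht.1]),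
    abs_of_nonpos (by linarith [ht.2]), abs_of_nonpos (by linarith [γ.len_nonneg])]
  ring

/-- Between two points of a segment there is a point of the segment at any prescribed
intermediate distance. -/
theorem exists_mem_dist_eq (γ : GeodesicSegment X) {p e : X} (hp : p ∈ γ.seg) (he : e ∈ γ.seg)
    {r : ℝ} (hr : 0 ≤ r) (hre : r ≤ dist p e) :
    ∃ q ∈ γ.seg, dist p q = r ∧ dist q e = dist p e - r := by
  obtain ⟨s, hs, rfl⟩ := hp
  obtain ⟨t, ht, rfl⟩ := he
  rw [γ.isom s hs t ht] at hre ⊢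
  rcases le_total s t with hst | hst
  · rw [abs_of_nonpos (by linarith)] at hre ⊢
    have hm : s + r ∈ Set.Icc 0 γ.len := ⟨by linarith [hs.1], by linarith [ht.2]⟩
    refine ⟨_, ⟨_, hm, rfl⟩, ?_, ?_⟩
    · rw [γ.isom _ hs _ hm, abs_of_nonpos (by linarith)]
      ring
    · rw [γ.isom _ hm _ ht, abs_of_nonpos (by linarith)]
      ring
  · rw [abs_of_nonneg (by linarith)] at hre ⊢
    have hm : s - r ∈ Set.Icc 0 γ.len := ⟨by linarith [ht.1], by linarith [hs.2]⟩
    refine ⟨_, ⟨_, hm, rfl⟩, ?_, ?_⟩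
    · rw [γ.isom _ hs _ hm, abs_of_nonneg (by linarith)]
      ring
    · rw [γ.isom _ hm _ ht, abs_of_nonneg (by linarith)]
      ring

end GeodesicSegment

theorem exists_dist_le_of_mem_cthickening {s : Set X} (hs : IsCompact s) {δ : ℝ} (hδ : 0 ≤ δ)
    {p : X} (hp : p ∈ Metric.cthickening δ s) : ∃ q ∈ s, dist p q ≤ δ := by
  rw [hs.cthickening_eq_biUnion_closedBall hδ] at hp
  simpa using hp

/-- A side of a slim triangle contains a point close to both other sides. -/
theorem IsDeltaHyperbolic.exists_dist_le_dist_le {δ : ℝ} (hδ : 0 ≤ δ)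
    (hhyp : IsDeltaHyperbolic X δ) {γ₁ γ₂ γ₃ : GeodesicSegment X}
    (h13 : γ₁.initial = γ₃.initial) (h12 : γ₁.terminal = γ₂.initial)
    (h23 : γ₂.terminal = γ₃.terminal) :
    ∃ p ∈ γ₃.seg, (∃ q ∈ γ₁.seg, dist p q ≤ δ) ∧ ∃ q ∈ γ₂.seg, dist p q ≤ δ := by
  have hsub := hhyp γ₁ γ₂ γ₃ h13 h12 h23
  rw [Metric.cthickening_union] at hsub
  obtain ⟨p, hp, hp1, hp2⟩ := isPreconnected_closed_iff.1 γ₃.isPreconnected_seg _ _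
    Metric.isClosed_cthickening Metric.isClosed_cthickening hsub
    ⟨γ₃.initial, γ₃.initial_mem, Metric.self_subset_cthickening _ (h13 ▸ γ₁.initial_mem)⟩
    ⟨γ₃.terminal, γ₃.terminal_mem, Metric.self_subset_cthickening _ (h23 ▸ γ₂.terminal_mem)⟩
  exact ⟨p, hp, exists_dist_le_of_mem_cthickening γ₁.isCompact_seg hδ hp1,
    exists_dist_le_of_mem_cthickening γ₂.isCompact_seg hδ hp2⟩

theorem gromovProd_le_dist_of_mem (γ : GeodesicSegment X) (w : X) {p : X} (hp : p ∈ γ.seg) :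
    gromovProd w γ.initial γ.terminal ≤ dist w p := by
  have h := γ.dist_add_dist_of_mem hp
  have h1 := dist_triangle γ.initial p w
  have h2 := dist_triangle w p γ.terminal
  have h3 := dist_comm w p
  simp only [gromovProd]
  linarith

theorem IsDeltaHyperbolic.fourPoint {δ : ℝ} (hδ : 0 ≤ δ) (hgeo : IsGeodesicSpace X)
    (hhyp : IsDeltaHyperbolic X δ) : FourPoint X (3 * δ) := by
  intro w x y z
  obtain ⟨xw, hxw, hxw'⟩ := hgeo x w
  obtain ⟨wz, hwz, hwz'⟩ := hgeo w z
  obtain ⟨xz, hxz, hxz'⟩ := hgeo x z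
  obtain ⟨xy, hxy, hxy'⟩ := hgeo x y
  obtain ⟨yz, hyz, hyz'⟩ := hgeo y z
  obtain ⟨p, hp, ⟨q, hq, hpq⟩, r, hr, hpr⟩ :=
    hhyp.exists_dist_le_dist_le hδ (hxw.trans hxz.symm) (hxw'.trans hwz.symm)
      (hwz'.trans hxz'.symm)
  have hwp : dist w p ≤ gromovProd w x z + 2 * δ := by
    have e1 := xw.dist_add_dist_of_mem hq
    have e2 := wz.dist_add_dist_of_mem hr
    have e3 := xz.dist_add_dist_of_mem hp
    rw [hxw, hxw'] at e1
    rw [hwz, hwz'] at e2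
    rw [hxz, hxz'] at e3
    have t1 := dist_triangle x q p
    have t2 := dist_triangle w q p
    have t3 := dist_triangle p r z
    have t4 := dist_triangle w r p
    have c1 := dist_comm p q
    have c2 := dist_comm p r
    have c3 := dist_comm w q
    simp only [gromovProd]
    linarith
  have hp' := hhyp xy yz xz (hxy.trans hxz.symm) (hxy'.trans hyz.symm) (hyz'.trans hxz'.symm) hp
  rw [Metric.cthickening_union] at hp'
  rcases hp' with hp' | hp'
  · obtain ⟨u, hu, hpu⟩ := exists_dist_le_of_mem_cthickening xy.isCompact_seg hδ hp'
    have h := gromovProd_le_dist_of_mem xy w hu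
    rw [hxy, hxy'] at h
    exact Or.inl (by linarith [dist_triangle w p u])
  · obtain ⟨u, hu, hpu⟩ := exists_dist_le_of_mem_cthickening yz.isCompact_seg hδ hp'
    have h := gromovProd_le_dist_of_mem yz w hu
    rw [hyz, hyz'] at h
    exact Or.inr (by linarith [dist_triangle w p u])

/-! ### Projections and alignment in terms of Gromov products -/

theorem proj_nonempty (γ : GeodesicSegment X) (y : X) : (proj γ y).Nonempty := by
  obtain ⟨p, hp, h⟩ := γ.isCompact_seg.exists_infDist_eq_dist ⟨_, γ.initial_mem⟩ y
  exact ⟨p, hp, h.symm⟩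

theorem gromovProd_le_of_mem_proj {D : ℝ} (hD : FourPoint X D) {γ : GeodesicSegment X}
    {y p e : X} (hp : p ∈ proj γ y) (he : e ∈ γ.seg) : gromovProd p e y ≤ 2 * D := by
  have hle : gromovProd p e y ≤ dist p e := by
    simp only [gromovProd]
    linarith [dist_triangle p e y, dist_comm p e]
  have hnn : 0 ≤ gromovProd p e y := by
    simp only [gromovProd]
    linarith [dist_triangle e p y]
  obtain ⟨q, hq, hpq, hqe⟩ := γ.exists_mem_dist_eq hp.1 he hnn hle
  have hyq : dist y p ≤ dist y q := hp.2 ▸ Metric.infDist_le_dist_of_mem hq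
  have key := hD p q e y
  have h1 : gromovProd p q e = dist p q := by
    have := dist_comm q p
    have := dist_comm e p
    simp only [gromovProd]
    linarith
  have h2 : gromovProd p q y ≤ dist p q / 2 := by
    have := dist_comm q p
    have := dist_comm y p
    have := dist_comm q y
    simp only [gromovProd]
    linarith
  rcases key with h | h <;> linarith

theorem gromovProd_le_of_diam_lt {D K : ℝ} (hD : FourPoint X D) {γ : GeodesicSegment X}
    {A : Set X} {y e f : X} (he : e ∈ γ.seg) (hf : f ∈ γ.seg) (hy : y ∈ A)
    (h : Metric.diam (projSet γ A ∪ {f}) < K) : gromovProd f e y ≤ K + 2 * D := by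
  obtain ⟨p, hp⟩ := proj_nonempty γ y
  have hb : Bornology.IsBounded (projSet γ A ∪ {f}) := by
    refine γ.isCompact_seg.isBounded.subset ?_
    rintro z (hz | rfl)
    · simp only [projSet, Set.mem_iUnion] at hz
      obtain ⟨_, _, hz⟩ := hz
      exact hz.1
    · exact hf
  have hpA : p ∈ projSet γ A ∪ {f} := Or.inl (Set.mem_biUnion hy hp)
  have hd := Metric.dist_le_diam_of_mem hb hpA (Or.inr rfl : f ∈ projSet γ A ∪ {f})
  have hg := gromovProd_le_of_mem_proj hD hp he
  have t1 := dist_triangle e p f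
  have t2 := dist_triangle f p y
  have c := dist_comm p f
  simp only [gromovProd] at hg ⊢
  linarith

theorem AlignedPair.gromovProd_terminal_le {D K : ℝ} (hD : FourPoint X D)
    {γ η : GeodesicSegment X} (h : AlignedPair K γ η) {y : X} (hy : y ∈ η.seg) :
    gromovProd γ.terminal γ.initial y ≤ K + 2 * D :=
  gromovProd_le_of_diam_lt hD γ.initial_mem γ.terminal_mem hy h.1

theorem AlignedPair.gromovProd_initial_le {D K : ℝ} (hD : FourPoint X D)
    {γ η : GeodesicSegment X} (h : AlignedPair K γ η) {y : X} (hy : y ∈ γ.seg) :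
    gromovProd η.initial η.terminal y ≤ K + 2 * D :=
  gromovProd_le_of_diam_lt hD η.terminal_mem η.initial_mem hy h.2

/-! ### Chains of aligned pairs of points -/

/-- The pair `(a, b)` is followed by the pair `(a', b')` without backtracking, up to `J`. -/
def Link (J : ℝ) (a b a' b' : X) : Prop :=
  gromovProd b a b' ≤ J ∧ gromovProd a' b b' ≤ J

theorem Link.mono {J J' : ℝ} (hJ : J ≤ J') {a b a' b' : X} (h : Link J a b a' b') :
    Link J' a b a' b' :=
  ⟨h.1.trans hJ, h.2.trans hJ⟩

theorem Link.map {J : ℝ} {a b a' b' : X} (h : Link J a b a' b') {f : X → X} (hf : Isometry f) :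
    Link J (f a) (f b) (f a') (f b') := by
  simpa only [Link, gromovProd_isometry hf] using h

theorem gromovProd_endpoint_le {J D ℓ : ℝ} (hD : FourPoint X D) (hℓ : 3 * J + 3 * D < ℓ)
    {x y a b : X} (hab : dist a b = ℓ) (hx : gromovProd a x b ≤ 2 * J + 2 * D)
    (hy : gromovProd b a y ≤ J) : gromovProd b x y ≤ J + D := by
  have c1 := dist_comm a x
  have c2 := dist_comm b x
  have c3 := dist_comm a b
  rcases hD b a x y with h | h
  · simp only [gromovProd] at *
    linarith
  · linarith

theorem Link.step {J D ℓ : ℝ} (hD : FourPoint X D) (hℓ : 3 * J + 3 * D < ℓ)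
    {x a b a' b' : X} (hab : dist a b = ℓ) (hab' : dist a' b' = ℓ) (hlink : Link J a b a' b')
    (hx : gromovProd a x b ≤ 2 * J + 2 * D) :
    gromovProd a' x b' ≤ 2 * J + 2 * D ∧ dist x b + (ℓ - (3 * J + 2 * D)) ≤ dist x b' := by
  have h1 := gromovProd_endpoint_le hD hℓ hab hx hlink.1
  have h2 := hlink.2
  have t := dist_triangle b b' a'
  have t' := dist_triangle b a' b'
  have t'' := dist_triangle a' b b'
  have t3 := dist_triangle x b b'
  have c1 := dist_comm a' b
  have c2 := dist_comm a' b'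
  have c3 := dist_comm a' x
  have c4 := dist_comm b b'
  have c5 := dist_comm x b
  have h4 := hD b' x b a'
  simp only [gromovProd] at *
  refine ⟨?_, by linarith⟩
  rcases h4 with h | h <;> linarith

theorem link_chain {J D ℓ : ℝ} (hD : FourPoint X D) (hℓ : 3 * J + 3 * D < ℓ) {x : X}
    {a b : ℕ → X} {M : ℕ} (hab : ∀ i ≤ M, dist (a i) (b i) = ℓ)
    (hlink : ∀ i < M, Link J (a i) (b i) (a (i + 1)) (b (i + 1)))
    (hx : gromovProd (a 0) x (b 0) ≤ 2 * J + 2 * D) :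
    gromovProd (a M) x (b M) ≤ 2 * J + 2 * D ∧
      dist x (b 0) + M * (ℓ - (3 * J + 2 * D)) ≤ dist x (b M) := by
  induction M with
  | zero => simpa using hx
  | succ M ih =>
    obtain ⟨h1, h2⟩ := ih (fun i hi => hab i (by omega)) (fun i hi => hlink i (by omega))
    obtain ⟨h3, h4⟩ := Link.step hD hℓ (hab M (by omega)) (hab (M + 1) le_rfl)
      (hlink M (by omega)) h1
    refine ⟨h3, ?_⟩
    push_cast
    linarith

/-- If `u` and `v` both project near `b` and `z` lies coarsely between them, then so does `z`. -/
theorem gromovProd_le_of_between {J C D : ℝ} (hD : FourPoint X D) {a b u v z : X}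
    (hz : gromovProd z u v ≤ C) (hu : gromovProd b a u ≤ J) (hv : gromovProd b a v ≤ J) :
    gromovProd b a z ≤ J + C + D := by
  have t1 := dist_triangle a z u
  have t2 := dist_triangle a z v
  have c1 := dist_comm b u
  have c2 := dist_comm z u
  have c3 := dist_comm z v
  have c4 := dist_comm b v
  have c5 := dist_comm b z
  rcases hD b u z v with h | h <;> simp only [gromovProd] at * <;> linarith

theorem link_iterate {K D ℓ : ℝ} (hD : FourPoint X D) (hD0 : 0 ≤ D) (hK : 0 ≤ K)
    (hℓ : 3 * K + 3 * D < ℓ) {f : X → X} (hf : Isometry f) {x x' : X} (hx' : f x' = x)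
    {a b : ℕ → X} {M : ℕ} (hab : ∀ i ≤ M, dist (a i) (b i) = ℓ)
    (hlink : ∀ i < M, Link K (a i) (b i) (a (i + 1)) (b (i + 1)))
    (hlink' : ∀ i < M, Link K (b (i + 1)) (a (i + 1)) (b i) (a i))
    (hx : gromovProd (a 0) (b 0) x ≤ K) (hxx : gromovProd (a 0) (b 0) x' ≤ K)
    (hy : gromovProd (b M) (a M) (f x) ≤ K) (hyy : gromovProd (b M) (a M) (f (f x)) ≤ K) :
    Link (3 * K + 4 * D) (a M) (b M) (f (a 0)) (f (b 0)) := by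
  have hxM : gromovProd (b M) x (f x) ≤ 2 * K + 3 * D := by
    have h := (link_chain hD hℓ hab hlink (x := x)
      (by rw [gromovProd_comm]; linarith)).1
    linarith [gromovProd_endpoint_le hD hℓ (hab M le_rfl) h hy]
  have hx0 : gromovProd (b 0) x (f x) ≤ 2 * K + 3 * D := by
    have h := (link_chain hD hℓ (x := f x) (a := fun i => b (M - i)) (b := fun i => a (M - i))
      (M := M) (fun i _ => by rw [dist_comm]; exact hab _ (by omega))
      (fun i hi => by
        have := hlink' (M - (i + 1)) (by omega)
        rwa [show M - (i + 1) + 1 = M - i by omega] at this)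
      (by rw [gromovProd_comm]; simp only [Nat.sub_zero]; linarith)).1
    simp only [Nat.sub_self] at h
    have h0 := hab 0 (Nat.zero_le _)
    have c1 := dist_comm (b 0) (a 0)
    have c2 := dist_comm (f x) (a 0)
    have c3 := dist_comm (f x) (b 0)
    have c4 := dist_comm x (b 0)
    have c5 := dist_comm x (a 0)
    rcases hD (b 0) (a 0) x (f x) with h1 | h1 <;> simp only [gromovProd] at * <;> linarith
  constructor
  · have h := gromovProd_le_of_between hD (z := f (b 0)) (C := 2 * K + 3 * D)
      (by rwa [gromovProd_isometry hf]) hy hyy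
    linarith
  · rw [gromovProd_comm]
    have h := gromovProd_le_of_between hD (a := f (b 0)) (b := f (a 0)) (u := x) (J := K) hxM
      (by rwa [← hx', gromovProd_isometry hf]) (by rwa [gromovProd_isometry hf])
    linarith

theorem isometry_iterate {f : X → X} (hf : Isometry f) (n : ℕ) : Isometry f^[n] := by
  induction n with
  | zero => exact isometry_id
  | succ n ih => exact ih.comp hf

theorem le_dist_iterate {J D ℓ : ℝ} (hD : FourPoint X D) (hD0 : 0 ≤ D) (hJ : 0 ≤ J)
    (hℓ : 3 * J + 3 * D < ℓ) {f : X → X} (hf : Isometry f) {x : X}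
    {a b : ℕ → X} {M : ℕ} (hab : ∀ i ≤ M, dist (a i) (b i) = ℓ)
    (hlink : ∀ i < M, Link J (a i) (b i) (a (i + 1)) (b (i + 1)))
    (hper : Link J (a M) (b M) (f (a 0)) (f (b 0)))
    (hx : gromovProd (a 0) (b 0) x ≤ J) (hy : gromovProd (b M) (a M) (f x) ≤ J) (k : ℕ) :
    ((k + 1 : ℕ) : ℝ) * (M + 1 : ℕ) * (ℓ - (5 * J + 4 * D)) ≤ dist x (f^[k + 1] x) := by
  have hblock (q : ℕ) (hq : gromovProd (f^[q] (a 0)) x (f^[q] (b 0)) ≤ 2 * J + 2 * D) :=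
    link_chain hD hℓ (a := fun i => f^[q] (a i)) (b := fun i => f^[q] (b i)) (M := M)
      (fun i hi => by rw [(isometry_iterate hf q).dist_eq, hab i hi])
      (fun i hi => (hlink i hi).map (isometry_iterate hf q)) hq
  have hstart (q : ℕ) : gromovProd (f^[q] (a 0)) x (f^[q] (b 0)) ≤ 2 * J + 2 * D ∧
      ((q : ℝ) * (M + 1) + 1) * (ℓ - (5 * J + 4 * D)) + (2 * J + 2 * D) ≤
        dist x (f^[q] (b 0)) := by
    induction q with
    | zero =>
      have h0 := hab 0 (Nat.zero_le _)
      have t := dist_triangle x (b 0) (a 0)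
      have c1 := dist_comm (b 0) (a 0)
      have c2 := dist_comm x (b 0)
      have c3 := dist_comm x (a 0)
      simp only [Function.iterate_zero, id_eq, Nat.cast_zero]
      rw [gromovProd_comm]
      refine ⟨by linarith, ?_⟩
      have t' := dist_triangle (b 0) x (a 0)
      simp only [gromovProd] at hx
      linarith
    | succ q ih =>
      obtain ⟨h1, h2⟩ := hblock q ih.1
      have hl := hper.map (isometry_iterate hf q)
      rw [← Function.iterate_succ_apply, ← Function.iterate_succ_apply] at hl
      obtain ⟨h3, h4⟩ := Link.step hD hℓ
        (by rw [(isometry_iterate hf q).dist_eq, hab M le_rfl])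
        (by rw [(isometry_iterate hf (q + 1)).dist_eq, hab 0 (Nat.zero_le _)]) hl h1
      refine ⟨h3, ?_⟩
      have hM : (0 : ℝ) ≤ (M : ℝ) * (2 * J + 2 * D) := by positivity
      push_cast
      linarith [ih.2]
  obtain ⟨h1, h2⟩ := hblock k (hstart k).1
  have hend : gromovProd (f^[k] (b M)) x (f^[k + 1] x) ≤ J + D := by
    refine gromovProd_endpoint_le hD hℓ ((isometry_iterate hf k).dist_eq _ _ |>.trans (hab M le_rfl)) h1 ?_
    rwa [Function.iterate_succ_apply, gromovProd_isometry (isometry_iterate hf k)]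
  have hM : (0 : ℝ) ≤ (M : ℝ) * (2 * J + 2 * D) := by positivity
  have hnn := dist_nonneg (x := f^[k] (b M)) (y := f^[k + 1] x)
  simp only [gromovProd] at hend
  push_cast
  linarith [(hstart k).2]

theorem alignedSeq_transList_iff {G : Type*} {ρ : G → X → X} (hisom : ∀ g : G, Isometry (ρ g))
    {Υ : GeodesicSegment X} {h : ℕ → G} {M : ℕ} {K : ℝ} {η θ : GeodesicSegment X} :
    AlignedSeq K ([η] ++ transList ρ hisom Υ h (M + 1) ++ [θ]) ↔
      AlignedPair K η (Υ.translate (ρ (h 1)) (hisom _)) ∧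
      (∀ i < M, AlignedPair K (Υ.translate (ρ (h (i + 1))) (hisom _))
        (Υ.translate (ρ (h (i + 2))) (hisom _))) ∧
      AlignedPair K (Υ.translate (ρ (h (M + 1))) (hisom _)) θ := by
  have hhead : (List.range (M + 1)).head? = some 0 := by
    rw [List.head?_range]; simp
  have hlast : (List.range (M + 1)).getLast? = some M := by
    rw [List.getLast?_range]; simp
  have hchain : List.IsChain (AlignedPair K) (transList ρ hisom Υ h (M + 1)) ↔
      ∀ i < M, AlignedPair K (Υ.translate (ρ (h (i + 1))) (hisom _))
        (Υ.translate (ρ (h (i + 2))) (hisom _)) := by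
    rw [transList, List.isChain_map, List.isChain_range_succ]
  have h1 : (transList ρ hisom Υ h (M + 1)).head? =
      some (Υ.translate (ρ (h 1)) (hisom _)) := by
    simp [transList, hhead]
  have h2 : (transList ρ hisom Υ h (M + 1)).getLast? =
      some (Υ.translate (ρ (h (M + 1))) (hisom _)) := by
    simp [transList, hlast]
  rw [AlignedSeq, List.append_assoc]
  change List.IsChain _ _ ↔ _
  rw [List.isChain_append, List.isChain_append, hchain, List.head?_append, h1, h2]
  simp
  tauto

end Hyperbolic

/-! ### Translation lengths -/

section Translation

variable {G : Type*} [Group G] {X : Type*} [MetricSpace X] {ρ : G → X → X}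

theorem subadditive_dist_pow (hisom : ∀ g : G, Isometry (ρ g))
    (hmul : ∀ g h : G, ∀ x : X, ρ (g * h) x = ρ g (ρ h x)) (x : X) (g : G) :
    Subadditive fun n : ℕ => dist x (ρ (g ^ n) x) := by
  intro m n
  have h := dist_triangle x (ρ (g ^ m) x) (ρ (g ^ (m + n)) x)
  rwa [pow_add, hmul, (hisom _).dist_eq, ← hmul, ← pow_add] at h

theorem bddBelow_dist_pow_div (x : X) (g : G) :
    BddBelow (Set.range fun n : ℕ => dist x (ρ (g ^ n) x) / n) :=
  ⟨0, by rintro _ ⟨n, rfl⟩; positivity⟩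

end Translation

theorem rho_pow_eq_iterate {G : Type*} [Group G] {X : Type*} {ρ : G → X → X}
    (hmul : ∀ g h : G, ∀ x : X, ρ (g * h) x = ρ g (ρ h x)) (hone : ∀ x : X, ρ 1 x = x) (g : G) (n : ℕ) (x : X) : ρ (g ^ n) x = (ρ g)^[n] x := by
  induction n with
  | zero => simp [hone]
  | succ n ih => rw [pow_succ', hmul, ih, Function.iterate_succ_apply']

/-- Lemma 4.4(1): elements of `W_{L,ε}(n)` are loxodromic with a linear lower bound
on displacement and translation length. -/
theorem Wset_loxodromic_translation {G : Type*} [Group G] {X : Type*} [MetricSpace X]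
    (S : Finset G) (hSgen : Subgroup.closure (S : Set G) = ⊤)
    (hNVC : NonVirtuallyCyclic G)
    (δ : ℝ) (hδ : 0 < δ) (hgeo : IsGeodesicSpace X) (hhyp : IsDeltaHyperbolic X δ)
    (ρ : G → X → X) (hisom : ∀ g : G, Isometry (ρ g))
    (hmul : ∀ g h : G, ∀ x : X, ρ (g * h) x = ρ g (ρ h x)) (hone : ∀ x : X, ρ 1 x = x)
    (x0 : X) (φ : G)
    (τ : ℝ) (hτpos : 0 < τ)
    (hτ : Filter.Tendsto (fun n : ℕ => dist x0 (ρ (φ ^ n) x0) / n) Filter.atTop (nhds τ))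
    (hwpd : HasWPD ρ x0 φ)
    (E0 : ℝ) (hE0 : E0Spec S ρ x0 φ E0) :
    ∃ L1 : ℝ, 0 < L1 ∧ ∀ L : ℕ, L1 < (L : ℝ) →
      ∀ Υ : GeodesicSegment X, Υ.initial = x0 → Υ.terminal = ρ (φ ^ L) x0 →
      ∀ ε : ℝ, 0 < ε → ∀ n : ℕ, 1 ≤ ⌈ε * (n:ℝ)⌉₊ →
        ∀ g ∈ Wset S ρ hisom x0 δ E0 Υ ε n,
          (∀ k : ℕ, 1 ≤ k →
            (1/2) * τ * (L : ℝ) * ((⌈ε * (n:ℝ)⌉₊ : ℕ) : ℝ) * (k : ℝ)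
              ≤ dist x0 (ρ (g ^ k) x0)) ∧
          ∃ τg : ℝ, 0 < τg ∧ (1/2) * τ * (L : ℝ) * ((⌈ε * (n:ℝ)⌉₊ : ℕ) : ℝ) ≤ τg ∧
            Filter.Tendsto (fun k : ℕ => dist x0 (ρ (g ^ k) x0) / k)
              Filter.atTop (nhds τg) := by
  have hD : FourPoint X (3 * δ) := hhyp.fourPoint hδ.le hgeo
  have hE0pos : 0 < E0 := hE0.1
  obtain ⟨K, hK⟩ : ∃ K, K = 6 * E0 + 360 * δ + 2 * (3 * δ) := ⟨_, rfl⟩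
  obtain ⟨J, hJ⟩ : ∃ J, J = 3 * K + 4 * (3 * δ) := ⟨_, rfl⟩
  have hKpos : 0 < K := by rw [hK]; positivity
  have hJpos : 0 < J := by rw [hJ]; positivity
  have hKJ : K ≤ J := by rw [hJ]; linarith
  refine ⟨2 * (5 * J + 4 * (3 * δ)) / τ, by positivity, ?_⟩
  intro L hL Υ hΥ hΥ' ε _ n hm g hg
  rw [div_lt_iff₀ hτpos] at hL
  obtain ⟨-, h, hseq, hfst, hlst⟩ := hg
  replace hlst : AlignedPair (6 * E0 + 360 * δ)
    (Υ.translate (ρ (h ⌈ε * (n:ℝ)⌉₊)) (hisom (h ⌈ε * (n:ℝ)⌉₊)))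
    (GeodesicSegment.point (ρ (g ^ 2) x0)) := hlst
  generalize ⌈ε * (n : ℝ)⌉₊ = m at hm hseq hlst ⊢
  obtain ⟨M, rfl⟩ := Nat.exists_eq_add_of_le' hm
  obtain ⟨hx, hpair, hy⟩ := (alignedSeq_transList_iff hisom).1 hseq
  have hLpos : 0 < (L : ℝ) := by
    refine pos_of_mul_pos_left ?_ hτpos.le
    linarith
  have hℓ : τ * L ≤ dist x0 (ρ (φ ^ L) x0) := by
    have hsub := subadditive_dist_pow hisom hmul x0 φ
    have hb := bddBelow_dist_pow_div (ρ := ρ) x0 φ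
    have hle := hsub.lim_le_div hb (n := L) (by rintro rfl; simp at hLpos)
    rwa [tendsto_nhds_unique (hsub.tendsto_lim hb) hτ, le_div_iff₀ hLpos] at hle
  have hpt (p : X) : p ∈ (GeodesicSegment.point p).seg :=
    (GeodesicSegment.point p).initial_mem
  have hi (k : G) : (Υ.translate (ρ k) (hisom k)).initial = ρ k x0 := by
    rw [← hΥ]; rfl
  have ht (k : G) : (Υ.translate (ρ k) (hisom k)).terminal = ρ k (ρ (φ ^ L) x0) := by
    rw [← hΥ']; rfl
  have hab (i : ℕ) (_ : i ≤ M) :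
      dist (ρ (h (i + 1)) x0) (ρ (h (i + 1)) (ρ (φ ^ L) x0)) = dist x0 (ρ (φ ^ L) x0) :=
    (hisom _).dist_eq _ _
  have hlink (i : ℕ) (hiM : i < M) : Link K (ρ (h (i + 1)) x0) (ρ (h (i + 1)) (ρ (φ ^ L) x0))
      (ρ (h (i + 1 + 1)) x0) (ρ (h (i + 1 + 1)) (ρ (φ ^ L) x0)) := by
    have h1 := (hpair i hiM).gromovProd_terminal_le hD (GeodesicSegment.terminal_mem _)
    have h2 := (hpair i hiM).gromovProd_initial_le hD (GeodesicSegment.terminal_mem _)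
    rw [hi, ht, ht, ← hK] at h1
    rw [hi, ht, ht, ← hK, gromovProd_comm] at h2
    exact ⟨h1, h2⟩
  have hlink' (i : ℕ) (hiM : i < M) : Link K (ρ (h (i + 1 + 1)) (ρ (φ ^ L) x0))
      (ρ (h (i + 1 + 1)) x0) (ρ (h (i + 1)) (ρ (φ ^ L) x0)) (ρ (h (i + 1)) x0) := by
    have h1 := (hpair i hiM).gromovProd_initial_le hD (GeodesicSegment.initial_mem _)
    have h2 := (hpair i hiM).gromovProd_terminal_le hD (GeodesicSegment.initial_mem _)
    rw [hi, hi, ht, ← hK] at h1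
    rw [hi, hi, ht, ← hK, gromovProd_comm] at h2
    exact ⟨h1, h2⟩
  have hstart := hx.gromovProd_initial_le hD (hpt _)
  have hstart' := hfst.gromovProd_initial_le hD (hpt _)
  have hend := hy.gromovProd_terminal_le hD (hpt _)
  have hend' := hlst.gromovProd_terminal_le hD (hpt _)
  rw [hi, ht, ← hK] at hstart hstart' hend hend'
  rw [pow_two, hmul] at hend'
  have hg' : ρ g (ρ g⁻¹ x0) = x0 := by rw [← hmul, mul_inv_cancel, hone]
  have hper := link_iterate hD (by positivity) hKpos.le (by linarith) (hisom g) hg'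
    (a := fun i => ρ (h (i + 1)) x0) (b := fun i => ρ (h (i + 1)) (ρ (φ ^ L) x0))
    hab hlink hlink' hstart hstart' hend hend'
  rw [← hJ] at hper
  have hmain (k : ℕ) (hk : 1 ≤ k) :
      (1/2) * τ * (L : ℝ) * ((M + 1 : ℕ) : ℝ) * (k : ℝ) ≤ dist x0 (ρ (g ^ k) x0) := by
    obtain ⟨k, rfl⟩ := Nat.exists_eq_add_of_le' hk
    have hdist := le_dist_iterate hD (by positivity) hJpos.le (by linarith) (hisom g)
      (a := fun i => ρ (h (i + 1)) x0) (b := fun i => ρ (h (i + 1)) (ρ (φ ^ L) x0))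
      hab (fun i hiM => (hlink i hiM).mono hKJ) hper (hstart.trans hKJ) (hend.trans hKJ) k
    rw [rho_pow_eq_iterate hmul hone]
    refine le_trans ?_ hdist
    calc (1/2) * τ * (L : ℝ) * ((M + 1 : ℕ) : ℝ) * ((k + 1 : ℕ) : ℝ)
        = ((k + 1 : ℕ) : ℝ) * (M + 1 : ℕ) * (1 / 2 * (τ * L)) := by ring
      _ ≤ _ := by
        gcongr
        linarith
  refine ⟨hmain, ?_⟩
  have hlim := (subadditive_dist_pow hisom hmul x0 g).tendsto_lim
    (bddBelow_dist_pow_div (ρ := ρ) x0 g)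
  have hle := ge_of_tendsto hlim (b := (1/2) * τ * (L : ℝ) * ((M + 1 : ℕ) : ℝ)) (by
    filter_upwards [Filter.eventually_ge_atTop 1] with k hk
    rw [le_div_iff₀ (by exact_mod_cast hk)]
    exact hmain k hk)
  exact ⟨_, lt_of_lt_of_le (by positivity) hle, hle, hlim⟩

end AcylCount
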